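/- arXiv:2006.16093 — 3 statements merged into one kernel-verified Lean document; each statement's English description precedes it below -/
import Mathlib

section
/- Let p be an odd prime. The Hasse polynomial H_p(X) = ∑_{k=0}^{(p−1)/2} C((p−1)/2, k)² X^k, viewed as a polynomial over 𝔽_p, is squarefree (equivalently, separable: it has only simple roots in any algebraic closure of 𝔽_p). -/
open Polynomial in
/-- The Hasse polynomial `H_p(X) = ∑_{k=0}^{(p−1)/2} C((p−1)/2, k)² X^k` over `𝔽_p`. -/
noncomputable def hassePoly (p : ℕ) : Polynomial (ZMod p) :=
  ∑ k ∈ Finset.range ((p - 1) / 2 + 1), C ((((p - 1) / 2).choose k : ZMod p) ^ 2) * X ^ k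

open Polynomial in
theorem hassePoly_coeff (p k : ℕ) :
    (hassePoly p).coeff k = (((p - 1) / 2).choose k : ZMod p) ^ 2 := by
  simp only [hassePoly, finsetSum_coeff, coeff_C_mul, coeff_X_pow, mul_ite, mul_one, mul_zero,
    Finset.sum_ite_eq, Finset.mem_range]
  split_ifs with h
  · rfl
  · simp [Nat.choose_eq_zero_of_lt (show (p - 1) / 2 < k by omega)]

open Polynomial in
theorem hassePoly_eval_zero (p : ℕ) : (hassePoly p).eval 0 = 1 := by
  rw [← coeff_zero_eq_eval_zero, hassePoly_coeff]
  simp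

open Polynomial in
theorem hassePoly_eval_one (p : ℕ) (hodd : Odd p) :
    (hassePoly p).eval 1 = ((p - 1).choose ((p - 1) / 2) : ZMod p) := by
  obtain ⟨m, rfl⟩ := hodd
  have h : 2 * m / 2 = m := by omega
  simp only [hassePoly, eval_finsetSum, eval_mul, eval_C, eval_pow, eval_X, one_pow, mul_one,
    Nat.add_sub_cancel, h]
  rw [← Nat.sum_range_choose_sq m]
  push_cast
  rfl

theorem hassePoly_natDegree_le (p : ℕ) : (hassePoly p).natDegree ≤ (p - 1) / 2 :=
  Polynomial.natDegree_sum_le_of_forall_le _ _ fun _ hk =>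
    (Polynomial.natDegree_C_mul_X_pow_le _ _).trans
      (Nat.lt_succ_iff.mp (Finset.mem_range.mp hk))

theorem hassePoly_coeff_succ (p : ℕ) (hodd : Odd p) (k : ℕ) :
    4 * ((k : ZMod p) + 1) ^ 2 * (hassePoly p).coeff (k + 1) =
      (2 * (k : ZMod p) + 1) ^ 2 * (hassePoly p).coeff k := by
  rw [hassePoly_coeff, hassePoly_coeff]
  obtain ⟨m, hm⟩ := hodd
  have h : (p - 1) / 2 = m := by omega
  have hp : 2 * (m : ZMod p) + 1 = 0 := by
    have := congrArg (Nat.cast : ℕ → ZMod p) hm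
    push_cast [ZMod.natCast_self] at this
    exact this.symm
  rw [h]
  have key : (m.choose (k + 1) : ZMod p) * (k + 1) = m.choose k * (m - k) := by
    rcases le_or_gt k m with hk | hk
    · have := congrArg (Nat.cast : ℕ → ZMod p) (Nat.choose_succ_right_eq m k)
      push_cast [Nat.cast_sub hk] at this
      exact this
    · simp [Nat.choose_eq_zero_of_lt hk, Nat.choose_eq_zero_of_lt (hk.trans k.lt_succ_self)]
  have key' : 2 * ((m.choose (k + 1) : ZMod p) * (k + 1)) = -(m.choose k * (2 * k + 1)) := by
    linear_combination 2 * key + (m.choose k : ZMod p) * hp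
  linear_combination (2 * ((m.choose (k + 1) : ZMod p) * (k + 1)) - m.choose k * (2 * k + 1)) * key'

open Polynomial in
/-- The Hasse polynomial satisfies the Picard–Fuchs equation of the Legendre family. -/
theorem hassePoly_picardFuchs (p : ℕ) (hodd : Odd p) :
    4 * (X * (1 - X)) * derivative (derivative (hassePoly p)) +
      4 * (1 - 2 * X) * derivative (hassePoly p) - hassePoly p = 0 := by
  have h : 4 * (X * (1 - X)) * derivative (derivative (hassePoly p)) +
      4 * (1 - 2 * X) * derivative (hassePoly p) - hassePoly p =
      C 4 * derivative (X * derivative (hassePoly p)) -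
        C 4 * derivative (X * (X * derivative (hassePoly p))) - hassePoly p := by
    simp only [derivative_mul, derivative_X, map_ofNat]
    ring
  rw [h]
  ext k
  have hk := hassePoly_coeff_succ p hodd k
  rcases k with _ | k
  · simp [coeff_derivative] at hk ⊢
    linear_combination hk
  · simp only [coeff_sub, coeff_C_mul, coeff_derivative, coeff_X_mul, coeff_zero]
    push_cast at hk ⊢
    linear_combination hk

open Polynomial in
theorem Polynomial.not_dvd_X_sub_C_of_irreducible_of_eval_ne_zero {F : Type*} [Field F]
    {q f : F[X]} (hq : Irreducible q) (hqf : q ∣ f) {a : F} (ha : f.eval a ≠ 0) :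
    ¬ q ∣ X - C a := by
  intro h
  have h1 : q ∣ C (f.eval a) := by
    simpa using dvd_sub hqf (h.trans (X_sub_C_dvd_sub_C_eval (a := a) (p := f)))
  exact hq.not_isUnit (isUnit_of_dvd_unit h1 (isUnit_C.mpr ha.isUnit))

open Polynomial in
/-- A solution of a second-order linear differential equation, of degree less than the
characteristic, is squarefree if it has no common factor with the leading coefficient. -/
theorem Polynomial.squarefree_of_differential_equation {p : ℕ} [Fact p.Prime]
    {f a b c : (ZMod p)[X]} (hf : f ≠ 0) (hdeg : f.natDegree < p)
    (hode : a * derivative (derivative f) + b * derivative f + c * f = 0)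
    (ha : ∀ q, Irreducible q → q ∣ f → ¬ q ∣ a) : Squarefree f := by
  rw [squarefree_iff_no_irreducibles hf]
  intro q hq hqq
  obtain ⟨g, hg, hqg⟩ :=
    (FiniteMultiplicity.of_not_isUnit hq.not_isUnit hf).exists_eq_pow_mul_and_not_dvd
  have h2 : 2 ≤ multiplicity q f :=
    (FiniteMultiplicity.of_not_isUnit hq.not_isUnit hf).le_multiplicity_of_pow_dvd
      (by rwa [sq])
  obtain ⟨n, hn⟩ := Nat.exists_eq_add_of_le' h2
  rw [hn] at hg
  have hg0 : g ≠ 0 := by rintro rfl; simp at hqg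
  have hnp : n + 2 < p := by
    refine lt_of_le_of_lt ?_ hdeg
    rw [hg, natDegree_mul (pow_ne_zero _ hq.ne_zero) hg0, natDegree_pow]
    nlinarith [hq.natDegree_pos]
  have hdvd : q ∣ a * (C (((n + 2) * (n + 1) : ℕ) : ZMod p) * (derivative q ^ 2 * g)) := by
    rw [hg] at hode
    simp only [derivative_mul, derivative_pow, map_add, derivative_natCast,
      Nat.add_sub_cancel, show n + 2 - 1 = n + 1 by omega, C_eq_natCast] at hode
    refine ⟨-(a * ((n + 2) * derivative (derivative q) * g
      + 2 * (n + 2) * derivative q * derivative g + q * derivative (derivative g))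
      + b * ((n + 2) * derivative q * g + q * derivative g) + c * q * g), ?_⟩
    apply mul_left_cancel₀ (pow_ne_zero n hq.ne_zero)
    simp only [C_eq_natCast]
    push_cast at hode ⊢
    linear_combination hode
  have hprime := hq.prime
  rcases hprime.dvd_or_dvd hdvd with h | h
  · exact ha q hq ((dvd_mul_right q q).trans hqq) h
  rcases hprime.dvd_or_dvd h with h | h
  · refine hq.not_isUnit (isUnit_of_dvd_unit h (isUnit_C.mpr (IsUnit.mk0 _ ?_)))
    rw [Ne, ZMod.natCast_eq_zero_iff, (Fact.out : p.Prime).dvd_mul]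
    rintro (h | h) <;> have := Nat.le_of_dvd (by omega) h <;> omega
  rcases hprime.dvd_or_dvd h with h | h
  · exact hq.not_isUnit ((PerfectField.separable_of_irreducible hq).isUnit_of_dvd' dvd_rfl
      (hprime.dvd_of_dvd_pow h))
  · exact hqg h

/-- For an odd prime `p`, the Hasse polynomial is squarefree. -/
theorem hassePoly_squarefree (p : ℕ) (hp : p.Prime) (hodd : Odd p) :
    Squarefree (hassePoly p) := by
  have : Fact p.Prime := ⟨hp⟩
  have h0 : (hassePoly p).eval 0 ≠ 0 := by simp [hassePoly_eval_zero]
  have h1 : (hassePoly p).eval 1 ≠ 0 := by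
    rw [hassePoly_eval_one p hodd, Ne, ZMod.natCast_eq_zero_iff]
    intro h
    have := (hp.dvd_factorial.mp
      (h.trans (Dvd.intro _ ((mul_assoc _ _ _).symm.trans
        (Nat.choose_mul_factorial_mul_factorial (Nat.div_le_self (p - 1) 2))))))
    have := hp.pos
    omega
  have h4 : (4 : ZMod p) ≠ 0 := by
    have h : ¬ p ∣ 2 ^ 2 := fun h => by
      have := (Nat.prime_dvd_prime_iff_eq hp Nat.prime_two).mp (hp.dvd_of_dvd_pow h)
      exact absurd (this ▸ hodd) (by decide)
    rw [← ZMod.natCast_eq_zero_iff] at h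
    norm_num at h
    exact h
  refine Polynomial.squarefree_of_differential_equation (fun h => h0 (by simp [h])) ?_
    (a := Polynomial.C 4 * (Polynomial.X * (1 - Polynomial.X)))
    (b := 4 * (1 - 2 * Polynomial.X)) (c := -1) ?_ ?_
  · have := hassePoly_natDegree_le p
    have := hp.pos
    omega
  · rw [map_ofNat]
    linear_combination hassePoly_picardFuchs p hodd
  · intro q hq hqf h
    rcases hq.prime.dvd_or_dvd h with h | h
    · exact hq.not_isUnit (isUnit_of_dvd_unit h (Polynomial.isUnit_C.mpr h4.isUnit))
    rcases hq.prime.dvd_or_dvd h with h | h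
    · exact Polynomial.not_dvd_X_sub_C_of_irreducible_of_eval_ne_zero hq hqf h0 (by simpa using h)
    · exact Polynomial.not_dvd_X_sub_C_of_irreducible_of_eval_ne_zero hq hqf h1
        (by simpa using (dvd_neg.mpr h))
end

section
/- Let p be a prime and n ≥ 1. The field obtained from ℚ_p by adjoining a primitive (pⁿ − 1)-th root of unity, i.e., the cyclotomic extension CyclotomicField (pⁿ − 1) over ℚ_p, is a finite extension of ℚ_p of degree exactly n. -/
open Polynomial IsLocalRing

/-- A finite free module over an adically complete ring is adically complete. -/
theorem isAdicComplete_of_finite_free {A M : Type*} [CommRing A] (I : Ideal A) [IsAdicComplete I A]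
    [AddCommGroup M] [Module A M] [Module.Finite A M] [Module.Free A M] : IsAdicComplete I M := by
  rw [← AdicCompletion.of_bijective_iff]
  let e : A ≃ₗ[A] AdicCompletion I A :=
    .ofBijective (AdicCompletion.of I A) (AdicCompletion.of_bijective_iff.mpr inferInstance)
  have hM : Function.Bijective (AdicCompletion.ofTensorProduct I M) := by
    let b := (Module.Free.chooseBasis A M).equivFun
    have h := AdicCompletion.ofTensorProduct_naturality I b.toLinearMap
    have h1 : Function.Bijective (AdicCompletion.map I b.toLinearMap ∘
        AdicCompletion.ofTensorProduct I M) := by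
      rw [← LinearMap.coe_comp, h, LinearMap.coe_comp]
      exact (AdicCompletion.ofTensorProduct_bijective_of_pi_of_fintype I _).comp
        (b.baseChange A (AdicCompletion I A) M _).bijective
    exact (Function.Bijective.of_comp_iff' (AdicCompletion.congr I b).bijective _).mp h1
  convert hM.comp ((TensorProduct.lid A M).symm ≪≫ₗ e.rTensor M).bijective using 1
  ext1 x
  simp [e, show AdicCompletion.of I A 1 = 1 from rfl]

/-- **Hensel's lemma** in the finite free extension `A[X]/(G)` of a complete local ring `A`: if `P` is
separable over the residue field and divisible there by `G`, then `P` has a root in `A[X]/(G)`. -/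
theorem exists_aeval_eq_zero_adjoinRoot {A : Type*} [CommRing A] [IsLocalRing A]
    [IsAdicComplete (maximalIdeal A) A] {G P : A[X]} (hG : G.Monic) (hP : P.Monic)
    (hsep : (P.map (residue A)).Separable) (hdvd : G.map (residue A) ∣ P.map (residue A)) :
    ∃ x : AdjoinRoot G, aeval x P = 0 := by
  have := hG.finite_adjoinRoot
  have := hG.free_adjoinRoot
  set I := (maximalIdeal A).map (algebraMap A (AdjoinRoot G))
  have : IsAdicComplete I (AdjoinRoot G) :=
    (IsAdicComplete.map_algebraMap_iff _ _).mpr (isAdicComplete_of_finite_free _)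
  let ψ : ResidueField A →+* AdjoinRoot G ⧸ I :=
    Ideal.quotientMap I (algebraMap A (AdjoinRoot G)) Ideal.le_comap_map
  have hψ (Q : A[X]) : (Q.map (residue A)).eval₂ ψ (Ideal.Quotient.mk I (AdjoinRoot.root G)) =
      Ideal.Quotient.mk I (aeval (AdjoinRoot.root G) Q) := by
    rw [eval₂_map, aeval_def, hom_eval₂]
    rfl
  have h0 : Ideal.Quotient.mk I (aeval (AdjoinRoot.root G) P) = 0 := by
    rw [← hψ]
    refine eval₂_eq_zero_of_dvd_of_eval₂_eq_zero _ _ hdvd ?_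
    rw [hψ, AdjoinRoot.aeval_eq, AdjoinRoot.mk_self, map_zero]
  obtain ⟨x, hx, -⟩ := HenselianRing.is_henselian (I := I) (P.map (algebraMap A (AdjoinRoot G)))
    (hP.map _) (AdjoinRoot.root G) (by
      rwa [eval_map_algebraMap, ← Ideal.Quotient.eq_zero_iff_mem]) (by
      obtain ⟨a, b, hab⟩ := hsep
      have := congrArg (eval₂ ψ (Ideal.Quotient.mk I (AdjoinRoot.root G))) hab
      rw [eval₂_add, eval₂_mul, eval₂_mul, derivative_map, hψ, hψ, h0, mul_zero, zero_add,
        eval₂_one] at this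
      rw [derivative_map, eval_map_algebraMap]
      exact .of_mul_eq_one_right _ this)
  exact ⟨x, by rwa [IsRoot.def, eval_map_algebraMap] at hx⟩

theorem orderOf_unitOfCoprime_pow_sub_one {p n : ℕ} (hp : 1 < p) (hn : 1 ≤ n)
    (h : p.Coprime (p ^ n - 1)) : orderOf (ZMod.unitOfCoprime p h) = n := by
  have key (k : ℕ) : ZMod.unitOfCoprime p h ^ k = 1 ↔ p ^ n - 1 ∣ p ^ k - 1 := by
    rw [Units.ext_iff, ← Nat.modEq_iff_dvd' (Nat.one_le_pow _ _ (by lia)), Nat.ModEq.comm,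
      ← ZMod.natCast_eq_natCast_iff]
    simp
  refine (orderOf_eq_iff hn).mpr ⟨(key n).mpr dvd_rfl, fun k hk hk0 hk1 => ?_⟩
  have h1 := Nat.pow_lt_pow_right hp hk
  have h2 := Nat.one_lt_pow hk0.ne' hp
  have := Nat.le_of_dvd (by lia) ((key k).mp hk1)
  lia

section

variable {p m : ℕ} [hp : Fact p.Prime]

/-- An irreducible factor of `cyclotomic m` over the residue field of `ℤ_[p]` has degree the
multiplicative order of `p` modulo `m`. -/
theorem natDegree_of_irreducible_dvd_cyclotomic_residueField (h : p.Coprime m)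
    {g : (ResidueField ℤ_[p])[X]} (hg : Irreducible g) (hdvd : g ∣ cyclotomic m _) :
    g.natDegree = orderOf (ZMod.unitOfCoprime p h) := by
  let _ : Fintype (ResidueField ℤ_[p]) := .ofEquiv _ PadicInt.residueField.symm.toEquiv
  have hc : Fintype.card (ResidueField ℤ_[p]) = p ^ 1 := by
    rw [Fintype.card_congr PadicInt.residueField.toEquiv, ZMod.card, pow_one]
  rw [natDegree_of_dvd_cyclotomic_of_irreducible hc h hdvd hg]
  congr 1
  ext
  simp

/-- The order of `p` modulo `m` bounds the degree of `CyclotomicField m ℚ_[p]` from below. -/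
theorem le_finrank_cyclotomicField_padic (h : p.Coprime m) (hm : m ≠ 0) :
    orderOf (ZMod.unitOfCoprime p h) ≤ Module.finrank ℚ_[p] (CyclotomicField m ℚ_[p]) := by
  have : NeZero m := ⟨hm⟩
  have := IsCyclotomicExtension.finiteDimensional {m} ℚ_[p] (CyclotomicField m ℚ_[p])
  let ζ := IsCyclotomicExtension.zeta m ℚ_[p] (CyclotomicField m ℚ_[p])
  have hζ : IsPrimitiveRoot ζ m := IsCyclotomicExtension.zeta_spec ..
  have hint : IsIntegral ℤ_[p] ζ := hζ.isIntegral (NeZero.pos m) |>.tower_top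
  set f := minpoly ℤ_[p] ζ
  have hf : f.Monic := minpoly.monic hint
  have hdvd : f ∣ cyclotomic m ℤ_[p] := by
    refine minpoly.isIntegrallyClosed_dvd hint ?_
    rw [← eval_map_algebraMap, map_cyclotomic]
    exact hζ.isRoot_cyclotomic (NeZero.pos m)
  obtain ⟨g, hg, hgf⟩ := exists_irreducible_of_natDegree_pos
    (f := f.map (residue ℤ_[p])) (by rw [hf.natDegree_map]; exact minpoly.natDegree_pos hint)
  rw [← natDegree_of_irreducible_dvd_cyclotomic_residueField h hg
    (hgf.trans (by simpa using map_dvd (mapRingHom (residue ℤ_[p])) hdvd))]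
  calc g.natDegree ≤ (f.map (residue ℤ_[p])).natDegree :=
        natDegree_le_of_dvd hgf (hf.map _).ne_zero
    _ = (minpoly ℚ_[p] ζ).natDegree := by
        rw [minpoly.isIntegrallyClosed_eq_field_fractions' ℚ_[p] hint, hf.natDegree_map,
          hf.natDegree_map]
    _ ≤ _ := minpoly.natDegree_le ζ

/-- The order of `p` modulo `m` bounds the degree of `CyclotomicField m ℚ_[p]` from above. -/
theorem finrank_cyclotomicField_padic_le (h : p.Coprime m) (hm : m ≠ 0) :
    Module.finrank ℚ_[p] (CyclotomicField m ℚ_[p]) ≤ orderOf (ZMod.unitOfCoprime p h) := by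
  have : NeZero m := ⟨hm⟩
  have : NeZero (m : ResidueField ℤ_[p]) := by
    have : CharP (ResidueField ℤ_[p]) p :=
      charP_of_injective_ringHom (f := (PadicInt.residueField (p := p)).symm.toRingHom)
        (PadicInt.residueField (p := p)).symm.injective p
    exact ⟨fun h0 => hp.out.coprime_iff_not_dvd.mp h ((CharP.cast_eq_zero_iff _ p m).mp h0)⟩
  obtain ⟨g, hgm, hg, hgdvd⟩ := exists_monic_irreducible_factor
    (cyclotomic m (ResidueField ℤ_[p]))
    (not_isUnit_of_degree_pos _ (degree_cyclotomic_pos m _ (NeZero.pos m)))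
  rw [← natDegree_of_irreducible_dvd_cyclotomic_residueField h hg hgdvd]
  obtain ⟨G, rfl, hdeg, hG⟩ := lifts_and_natDegree_eq_and_monic
    ((mem_lifts _).mpr (Polynomial.map_surjective _ (residue_surjective (R := ℤ_[p])) g)) hgm
  have hirr : Irreducible (G.map (algebraMap ℤ_[p] ℚ_[p])) :=
    hG.irreducible_iff_irreducible_map_fraction_map.mp
      (hG.irreducible_of_irreducible_map _ G hg)
  have : Fact (Irreducible (G.map (algebraMap ℤ_[p] ℚ_[p]))) := ⟨hirr⟩
  have := (hG.map (algebraMap ℤ_[p] ℚ_[p])).finite_adjoinRoot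
  obtain ⟨x, hx⟩ := exists_aeval_eq_zero_adjoinRoot hG (cyclotomic.monic m ℤ_[p])
    (by rw [map_cyclotomic]; exact separable_cyclotomic m _) (by rwa [map_cyclotomic])
  set M := AdjoinRoot (G.map (algebraMap ℤ_[p] ℚ_[p]))
  let φ : AdjoinRoot G →+* M := AdjoinRoot.map (algebraMap ℤ_[p] ℚ_[p]) G _ dvd_rfl
  have hφ : IsPrimitiveRoot (φ x) m := by
    have : CharZero M := algebraRat.charZero M
    rw [← isRoot_cyclotomic_iff, ← map_cyclotomic m φ]
    refine IsRoot.map ?_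
    rwa [IsRoot.def, ← map_cyclotomic m (algebraMap ℤ_[p] _), eval_map_algebraMap]
  have hs : ((cyclotomic m ℚ_[p]).map (algebraMap ℚ_[p] M)).Splits := by
    rw [map_cyclotomic]
    exact (X_pow_sub_one_splits hφ).of_dvd (X_pow_sub_C_ne_zero (NeZero.pos m) _) (by
      simpa using cyclotomic.dvd_X_pow_sub_one m M)
  let i : CyclotomicField m ℚ_[p] →ₐ[ℚ_[p]] M := SplittingField.lift (cyclotomic m ℚ_[p]) hs
  calc _ ≤ Module.finrank ℚ_[p] M := LinearMap.finrank_le_finrank_of_injective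
          (f := i.toLinearMap) i.injective
    _ = _ := by
      rw [← hdeg, ← hG.natDegree_map (algebraMap ℤ_[p] ℚ_[p])]
      exact (AdjoinRoot.powerBasis hirr.ne_zero).finrank

end

/-- For a prime `p` and `n ≥ 1`, the extension of `ℚ_p` obtained by adjoining a primitive
`(pⁿ − 1)`-th root of unity (the cyclotomic extension `CyclotomicField (pⁿ − 1) ℚ_[p]`) has
degree exactly `n` over `ℚ_p`. -/
theorem finrank_cyclotomicField_padic (p n : ℕ) [hp : Fact p.Prime] (hn : 1 ≤ n)
    (m : ℕ+) (hm : (m : ℕ) = p ^ n - 1) :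
    Module.finrank ℚ_[p] (CyclotomicField m ℚ_[p]) = n := by
  have h : p.Coprime (p ^ n - 1) := by
    have h1 : p ^ n - 1 + 1 = p ^ n := Nat.sub_add_cancel (Nat.one_le_pow _ _ hp.out.pos)
    refine hp.out.coprime_iff_not_dvd.mpr fun hd => hp.out.one_lt.ne' (Nat.dvd_one.mp ?_)
    exact (Nat.dvd_add_right hd).mp (h1 ▸ dvd_pow_self p (Nat.ne_zero_of_lt hn))
  rw [hm]
  exact (le_antisymm (finrank_cyclotomicField_padic_le h (hm ▸ m.ne_zero))
    (le_finrank_cyclotomicField_padic h (hm ▸ m.ne_zero))).trans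
    (orderOf_unitOfCoprime_pow_sub_one hp.out.one_lt hn h)
end

section
/- Let p be a prime and n ≥ 1. The ring of Witt vectors W(𝔽_{pⁿ}) over the field with pⁿ elements is isomorphic, as a ring, to the valuation ring of the unramified extension ℚ_p(ζ_{pⁿ−1}) of ℚ_p, i.e., to the integral closure of ℤ_p in the cyclotomic extension CyclotomicField (pⁿ − 1) of ℚ_p. -/
namespace IsPrecomplete

/-- A finite power of an `I`-adically precomplete ring is `I`-adically precomplete. -/
theorem pi_const {R : Type*} [CommRing R] (I : Ideal R) [IsPrecomplete I R]
    (ι : Type*) [Finite ι] : IsPrecomplete I (ι → R) := by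
  classical
  have := Fintype.ofFinite ι
  have mem_iff (n : ℕ) (x : ι → R) :
      x ∈ (I ^ n • ⊤ : Submodule R (ι → R)) ↔ ∀ i, x i ∈ (I ^ n • ⊤ : Submodule R R) := by
    constructor
    · intro hx i
      have := Submodule.mem_map_of_mem (f := LinearMap.proj (R := R) (φ := fun _ : ι ↦ R) i) hx
      rw [Submodule.map_smul''] at this
      exact Submodule.smul_mono le_rfl le_top this
    · intro hx
      rw [pi_eq_sum_univ x]
      refine Submodule.sum_mem _ fun i _ ↦ Submodule.smul_mem_smul ?_ Submodule.mem_top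
      simpa using hx i
  refine ⟨fun f hf ↦ ?_⟩
  have exists_limit (i : ι) : ∃ L : R, ∀ n, f n i ≡ L [SMOD (I ^ n • ⊤ : Submodule R R)] := by
    refine IsPrecomplete.prec' (fun n ↦ f n i) fun {m n} hmn ↦ ?_
    have := hf hmn
    rw [SModEq.sub_mem, mem_iff] at this
    exact SModEq.sub_mem.2 (this i)
  choose L hL using exists_limit
  refine ⟨L, fun n ↦ ?_⟩
  rw [SModEq.sub_mem, mem_iff]
  exact fun i ↦ SModEq.sub_mem.1 (hL i n)

end IsPrecomplete

namespace WittVector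

open IsLocalRing

theorem teichmuller_injective (p : ℕ) [Fact p.Prime] (R : Type*) [CommRing R] :
    Function.Injective (teichmuller p : R → WittVector p R) :=
  Function.LeftInverse.injective (g := constantCoeff) (teichmuller_coeff_zero p)

variable (p : ℕ) [Fact p.Prime] (k : Type*) [Field k] [Algebra (ZMod p) k]

/-- The `ℤ_[p]`-algebra structure on the Witt vectors of a field of characteristic `p`, coming from
the identification of `ℤ_[p]` with the Witt vectors of `ZMod p`. -/
noncomputable abbrev padicIntAlgebra : Algebra ℤ_[p] (WittVector p k) :=
  ((map (algebraMap (ZMod p) k)).comp (fromPadicInt p)).toAlgebra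

attribute [local instance] padicIntAlgebra

theorem algebraMap_padicInt_injective :
    Function.Injective (algebraMap ℤ_[p] (WittVector p k)) :=
  (map_injective _ (algebraMap (ZMod p) k).injective).comp (equiv p).symm.injective

theorem map_maximalIdeal_padicInt :
    (maximalIdeal ℤ_[p]).map (algebraMap ℤ_[p] (WittVector p k)) =
      Ideal.span {(p : WittVector p k)} := by
  rw [PadicInt.maximalIdeal_eq_span_p, Ideal.map_span, Set.image_singleton, map_natCast]

variable [CharP k p]

/-- The fraction field of the Witt vectors of a field `k` of characteristic `p`, as an algebra
over `ℚ_[p]`. -/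
noncomputable abbrev padicAlgebraFractionRing : Algebra ℚ_[p] (FractionRing (WittVector p k)) :=
  (IsFractionRing.lift (A := ℤ_[p]) (K := ℚ_[p])
    (g := algebraMap ℤ_[p] (FractionRing (WittVector p k)))
    ((IsFractionRing.injective (WittVector p k) (FractionRing (WittVector p k))).comp
      (algebraMap_padicInt_injective p k))).toAlgebra

attribute [local instance] padicAlgebraFractionRing

theorem isScalarTower_padic :
    IsScalarTower ℤ_[p] ℚ_[p] (FractionRing (WittVector p k)) :=
  .of_algebraMap_eq fun x ↦ (IsFractionRing.lift_algebraMap _ x).symm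

variable [Finite k]

/-- The Witt vectors of a finite field are spanned over `ℤ_[p]` by the Teichmüller lifts. -/
theorem span_range_teichmuller :
    Submodule.span ℤ_[p] (Set.range (teichmuller p : k → WittVector p k)) = ⊤ := by
  classical
  have := Fintype.ofFinite k
  have : IsPrecomplete (maximalIdeal ℤ_[p]) (k → ℤ_[p]) := .pi_const _ _
  have : IsHausdorff (maximalIdeal ℤ_[p]) (WittVector p k) := by
    rw [← IsHausdorff.map_algebraMap_iff (S := WittVector p k), map_maximalIdeal_padicInt]
    infer_instance
  rw [← Fintype.range_linearCombination, LinearMap.range_eq_top]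
  refine surjective_of_mkQ_comp_surjective (I := maximalIdeal ℤ_[p]) fun y ↦ ?_
  obtain ⟨w, rfl⟩ := Submodule.mkQ_surjective _ y
  refine ⟨Pi.single (w.coeff 0) 1, ?_⟩
  rw [LinearMap.comp_apply, Fintype.linearCombination_apply_single, one_smul,
    ← sub_eq_zero, ← map_sub, Submodule.mkQ_apply, Submodule.Quotient.mk_eq_zero,
    Ideal.smul_top_eq_map, Submodule.restrictScalars_mem, map_maximalIdeal_padicInt,
    mem_span_p_iff_coeff_zero_eq_zero]
  change constantCoeff (teichmuller p (w.coeff 0) - w) = 0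
  rw [map_sub, sub_eq_zero]
  exact teichmuller_coeff_zero p _

theorem finite_padicInt : Module.Finite ℤ_[p] (WittVector p k) :=
  ⟨Submodule.fg_def.2 ⟨_, Set.finite_range _, span_range_teichmuller p k⟩⟩

/-- The fraction field of the Witt vectors of the field with `m + 1` elements is obtained from
`ℚ_[p]` by adjoining the `m`-th roots of unity. -/
theorem isCyclotomicExtension_fractionRing {m : ℕ} (hm : Nat.card k = m + 1) :
    IsCyclotomicExtension {m} ℚ_[p] (FractionRing (WittVector p k)) := by
  have := isScalarTower_padic p k
  have := finite_padicInt p k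
  set K := FractionRing (WittVector p k)
  have hinj : Function.Injective (algebraMap (WittVector p k) K) := IsFractionRing.injective _ _
  have hunits : Nat.card kˣ = m := by rw [Nat.card_units, hm, Nat.add_sub_cancel]
  set A := Algebra.adjoin ℚ_[p] {b : K | ∃ i ∈ ({m} : Set ℕ), i ≠ 0 ∧ b ^ i = 1}
  have hm0 : m ≠ 0 := hunits ▸ Nat.card_pos.ne'
  have hA (w : WittVector p k) : algebraMap (WittVector p k) K w ∈ A := by
    have hw : w ∈ Submodule.span ℤ_[p] (Set.range (teichmuller p : k → WittVector p k)) := by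
      rw [span_range_teichmuller]; trivial
    induction hw using Submodule.span_induction with
    | mem x hx =>
      obtain ⟨a, rfl⟩ := hx
      rcases eq_or_ne a 0 with rfl | ha
      · simp
      · refine Algebra.subset_adjoin ⟨m, rfl, hm0, ?_⟩
        have : a ^ m = 1 := by
          rw [← hunits]
          exact congrArg Units.val (pow_card_eq_one' (x := Units.mk0 a ha))
        rw [← map_pow, ← map_pow, this, map_one, map_one]
    | zero => simp
    | add x y _ _ hx hy => rw [map_add]; exact add_mem hx hy
    | smul c x _ hx =>
      rw [algebraMap.smul c x K, ← algebraMap_smul ℚ_[p] c]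
      exact A.smul_mem hx _
  refine ⟨fun {i} hi _ ↦ ?_, fun x ↦ ?_⟩
  · obtain rfl : i = m := hi
    obtain ⟨g, hg⟩ := IsCyclic.exists_generator (α := kˣ)
    have hprim : IsPrimitiveRoot g i := by
      rw [← hunits, ← orderOf_eq_card_of_forall_mem_zpowers hg]
      exact .orderOf g
    exact ⟨_, ((hprim.map_of_injective (f := Units.coeHom k) Units.val_injective).map_of_injective
      (teichmuller_injective p k)).map_of_injective hinj⟩
  · obtain ⟨w, s, -, rfl⟩ := IsFractionRing.div_surjective (A := WittVector p k) x
    rw [div_eq_mul_inv]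
    refine A.mul_mem (hA w) (A.inv_mem_of_algebraic (x := ⟨_, hA s⟩) ?_)
    have hs : IsIntegral ℤ_[p] (algebraMap (WittVector p k) K s) :=
      (Algebra.IsIntegral.isIntegral s).algebraMap
    exact hs.tower_top.isAlgebraic

/-- The Witt vectors of the field with `m + 1` elements are isomorphic to the integral closure of
`ℤ_[p]` in any extension of `ℚ_[p]` obtained by adjoining the `m`-th roots of unity. -/
theorem nonempty_ringEquiv_integralClosure {m : ℕ} (hm : Nat.card k = m + 1)
    (L : Type*) [Field L] [Algebra ℚ_[p] L] [IsCyclotomicExtension {m} ℚ_[p] L]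
    [Algebra ℤ_[p] L] [IsScalarTower ℤ_[p] ℚ_[p] L] :
    Nonempty (WittVector p k ≃+* integralClosure ℤ_[p] L) := by
  have := isScalarTower_padic p k
  have := finite_padicInt p k
  have := isCyclotomicExtension_fractionRing p k hm
  have : IsIntegralClosure (WittVector p k) ℤ_[p] (FractionRing (WittVector p k)) :=
    .of_isIntegrallyClosed _ _ _
  let e := IsCyclotomicExtension.algEquiv {m} ℚ_[p] (FractionRing (WittVector p k)) L
  exact ⟨((IsIntegralClosure.equiv ℤ_[p] (WittVector p k) (FractionRing (WittVector p k))
    (integralClosure ℤ_[p] (FractionRing (WittVector p k)))).trans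
      (e.restrictScalars ℤ_[p]).mapIntegralClosure).toRingEquiv⟩

end WittVector

/-- For a prime `p` and `n ≥ 1`, the ring of Witt vectors `W(𝔽_{pⁿ})` is isomorphic as a ring
to the valuation ring of the unramified extension `ℚ_p(ζ_{pⁿ−1})` of `ℚ_p`, i.e. to the integral
closure of `ℤ_p` in the cyclotomic extension `CyclotomicField (pⁿ − 1) ℚ_[p]`. -/
theorem wittVector_iso_integralClosure (p n : ℕ) [hp : Fact p.Prime] (hn : 1 ≤ n)
    (m : ℕ+) (hm : (m : ℕ) = p ^ n - 1) :
    letI : Algebra ℤ_[p] (CyclotomicField m ℚ_[p]) :=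
      ((algebraMap ℚ_[p] (CyclotomicField m ℚ_[p])).comp
        (algebraMap ℤ_[p] ℚ_[p])).toAlgebra
    Nonempty
      (WittVector p (GaloisField p n) ≃+* integralClosure ℤ_[p] (CyclotomicField m ℚ_[p])) := by
  let : Algebra ℤ_[p] (CyclotomicField m ℚ_[p]) :=
    ((algebraMap ℚ_[p] (CyclotomicField m ℚ_[p])).comp
      (algebraMap ℤ_[p] ℚ_[p])).toAlgebra
  have := IsScalarTower.of_algebraMap_eq (R := ℤ_[p]) (S := ℚ_[p])
    (A := CyclotomicField m ℚ_[p]) fun _ ↦ rfl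
  have hcard : Nat.card (GaloisField p n) = m + 1 := by
    rw [GaloisField.card p n (by omega), hm, Nat.sub_add_cancel (Nat.one_le_pow _ _ hp.out.pos)]
  exact WittVector.nonempty_ringEquiv_integralClosure p (GaloisField p n) hcard
    (CyclotomicField m ℚ_[p])
end
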